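/- In the root system of type F₄ with highest root θ, the number of upper sets Φ of the poset of positive roots (Δ⁺, ≤) such that θ ∉ Φ² (where Φ² = {α + β : α, β ∈ Φ} ∩ Δ⁺) is 16 = 2⁴; equivalently, the Borel subalgebra of the simple Lie algebra of type F₄ has exactly 16 abelian ideals. -/

import Mathlib

/-- The roots of the root system of type `F₄`, realized (scaled by a factor 2) as the integer
vectors of squared length `4` (`±2eᵢ` and `(±1,±1,±1,±1)`, the short roots) and of squared
length `8` (`±2eᵢ ± 2eⱼ`, `i ≠ j`, the long roots). -/
def F4roots : Set (Fin 4 → ℤ) :=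
  {v | ∑ i, v i ^ 2 = 4 ∨ ∑ i, v i ^ 2 = 8}

/-- A system of positive roots for `F₄`: the roots on which the (generic) linear functional
`v ↦ ∑ i, 2 ^ i * v i` is positive. -/
def F4pos : Set (Fin 4 → ℤ) :=
  {v | v ∈ F4roots ∧ 0 < ∑ i : Fin 4, 2 ^ i.val * v i}

/-- The partial order on positive roots: `α ≤ β` iff `β − α` is a (possibly empty) sum of
positive roots. -/
def rootLe (pos : Set (Fin 4 → ℤ)) (a b : Fin 4 → ℤ) : Prop :=
  ∃ l : Multiset (Fin 4 → ℤ), (∀ x ∈ l, x ∈ pos) ∧ b = a + l.sum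

/-- The positive roots of `F₄`, as an explicit list of vectors. -/
def F4posFinset : Finset (Fin 4 → ℤ) :=
  {![0, 0, 2, 2], ![0, 2, 0, 2], ![2, 0, 0, 2], ![0, 0, 0, 2], ![-2, 0, 0, 2], ![1, 1, 1, 1],
   ![-1, 1, 1, 1], ![0, -2, 0, 2], ![0, 0, -2, 2], ![0, 2, 2, 0], ![1, -1, 1, 1], ![-1, -1, 1, 1],
   ![1, 1, -1, 1], ![2, 0, 2, 0], ![-1, 1, -1, 1], ![0, 0, 2, 0], ![2, 2, 0, 0], ![-2, 0, 2, 0],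
   ![0, 2, 0, 0], ![1, -1, -1, 1], ![-2, 2, 0, 0], ![-1, -1, -1, 1], ![0, -2, 2, 0], ![2, 0, 0, 0]}

/-- The positive roots lying in some abelian ideal, smaller roots first. -/
def F4abelianSupport : List (Fin 4 → ℤ) :=
  [![0, 2, 2, 0], ![0, 0, -2, 2], ![0, -2, 0, 2], ![-1, 1, 1, 1], ![1, 1, 1, 1],
   ![-2, 0, 0, 2], ![0, 0, 0, 2], ![2, 0, 0, 2], ![0, 2, 0, 2], ![0, 0, 2, 2]]

/-- The highest root. -/
def F4highest : Fin 4 → ℤ := ![0, 0, 2, 2]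

/-- Nonnegativity of the (suitably scaled) coordinates with respect to the simple roots
`(0, -2, 2, 0)`, `(-2, 2, 0, 0)`, `(2, 0, 0, 0)` and `(-1, -1, -1, 1)`. -/
def simpleNonneg (v : Fin 4 → ℤ) : Prop :=
  0 ≤ v 3 ∧ 0 ≤ v 2 + v 3 ∧ 0 ≤ v 1 + v 2 + 2 * v 3 ∧ 0 ≤ v 0 + v 1 + v 2 + 3 * v 3

instance : DecidablePred simpleNonneg := fun _ => inferInstanceAs (Decidable (_ ∧ _))

lemma simpleNonneg_sum {l : Multiset (Fin 4 → ℤ)} (h : ∀ x ∈ l, simpleNonneg x) :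
    simpleNonneg l.sum := by
  induction l using Multiset.induction with
  | empty => simp [simpleNonneg]
  | cons a l ih =>
    have ha := h a (Multiset.mem_cons_self a l)
    have hl := ih fun x hx => h x (Multiset.mem_cons_of_mem hx)
    simp only [simpleNonneg, Multiset.sum_cons, Pi.add_apply] at ha hl ⊢
    omega

lemma F4pos_eq : F4pos = ↑F4posFinset := by
  have key : ∀ a ∈ ([-2, -1, 0, 1, 2] : List ℤ), ∀ b ∈ ([-2, -1, 0, 1, 2] : List ℤ),
      ∀ c ∈ ([-2, -1, 0, 1, 2] : List ℤ), ∀ d ∈ ([-2, -1, 0, 1, 2] : List ℤ),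
      ((a ^ 2 + b ^ 2 + c ^ 2 + d ^ 2 = 4 ∨ a ^ 2 + b ^ 2 + c ^ 2 + d ^ 2 = 8) ∧
        0 < a + 2 * b + 4 * c + 8 * d) → ![a, b, c, d] ∈ F4posFinset := by
    decide +kernel
  have key' : ∀ v ∈ F4posFinset, (∑ i, v i ^ 2 = 4 ∨ ∑ i, v i ^ 2 = 8) ∧
      0 < ∑ i : Fin 4, 2 ^ i.val * v i := by
    decide +kernel
  ext v
  refine ⟨fun ⟨h1, h2⟩ => ?_, fun hv => key' v hv⟩
  have hvec : v = ![v 0, v 1, v 2, v 3] := by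
    ext i; fin_cases i <;> rfl
  have h8 : ∑ i, v i ^ 2 ≤ 8 := by
    rcases h1 with h | h <;> omega
  have hb : ∀ i, v i ∈ ([-2, -1, 0, 1, 2] : List ℤ) := fun i => by
    have h := (Finset.single_le_sum (fun j _ => sq_nonneg (v j)) (Finset.mem_univ i)).trans h8
    have h1 : -2 ≤ v i := by nlinarith
    have h2 : v i ≤ 2 := by nlinarith
    simp only [List.mem_cons, List.not_mem_nil, or_false]
    omega
  rw [hvec]
  refine key _ (hb 0) _ (hb 1) _ (hb 2) _ (hb 3) ?_
  simp only [F4roots, Set.mem_ofPred_eq, Fin.sum_univ_four] at h1 h2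
  refine ⟨h1, ?_⟩
  norm_num at h2
  exact h2

lemma mem_F4pos {v : Fin 4 → ℤ} : v ∈ F4pos ↔ v ∈ F4posFinset := by
  rw [F4pos_eq, Finset.mem_coe]

lemma rootLe_F4pos_iff {a b : Fin 4 → ℤ} (ha : a ∈ F4posFinset) (hb : b ∈ F4posFinset) :
    rootLe F4pos a b ↔ simpleNonneg (b - a) := by
  have hpos : ∀ v ∈ F4posFinset, simpleNonneg v := by decide +kernel
  have hpar : ∀ v ∈ F4posFinset, v 0 % 2 = v 3 % 2 ∧ v 1 % 2 = v 3 % 2 ∧ v 2 % 2 = v 3 % 2 := by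
    decide +kernel
  rw [F4pos_eq]
  constructor
  · rintro ⟨l, hl, rfl⟩
    rw [add_sub_cancel_left]
    exact simpleNonneg_sum fun x hx => hpos x (hl x hx)
  · rintro ⟨h0, h1, h2, h3⟩
    obtain ⟨pa0, pa1, pa2⟩ := hpar a ha
    obtain ⟨pb0, pb1, pb2⟩ := hpar b hb
    simp only [Pi.sub_apply] at h0 h1 h2 h3
    obtain ⟨k0, hk0⟩ : ∃ k : ℕ, (k : ℤ) = b 3 - a 3 := ⟨(b 3 - a 3).toNat, by omega⟩
    obtain ⟨k1, hk1⟩ : ∃ k : ℕ, 2 * (k : ℤ) = b 2 - a 2 + (b 3 - a 3) :=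
      ⟨((b 2 - a 2 + (b 3 - a 3)) / 2).toNat, by omega⟩
    obtain ⟨k2, hk2⟩ : ∃ k : ℕ, 2 * (k : ℤ) = b 1 - a 1 + (b 2 - a 2) + 2 * (b 3 - a 3) :=
      ⟨((b 1 - a 1 + (b 2 - a 2) + 2 * (b 3 - a 3)) / 2).toNat, by omega⟩
    obtain ⟨k3, hk3⟩ : ∃ k : ℕ,
        2 * (k : ℤ) = b 0 - a 0 + (b 1 - a 1) + (b 2 - a 2) + 3 * (b 3 - a 3) :=
      ⟨((b 0 - a 0 + (b 1 - a 1) + (b 2 - a 2) + 3 * (b 3 - a 3)) / 2).toNat, by omega⟩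
    refine ⟨Multiset.replicate k0 ![-1, -1, -1, 1] + Multiset.replicate k1 ![0, -2, 2, 0] +
      Multiset.replicate k2 ![-2, 2, 0, 0] + Multiset.replicate k3 ![2, 0, 0, 0], ?_, ?_⟩
    · intro x hx
      simp only [Multiset.mem_add, or_assoc] at hx
      rcases hx with hx | hx | hx | hx <;> rw [Multiset.eq_of_mem_replicate hx] <;>
        rw [Finset.mem_coe] <;> decide +kernel
    · ext i
      fin_cases i <;> simp <;> omega

lemma eq_F4highest {θ : Fin 4 → ℤ} (hθ : θ ∈ F4pos ∧ ∀ α ∈ F4pos, rootLe F4pos α θ) :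
    θ = F4highest := by
  have hmem : F4highest ∈ F4posFinset := by decide +kernel
  have hmax : ∀ v ∈ F4posFinset, simpleNonneg (v - F4highest) → v = F4highest := by
    decide +kernel
  obtain ⟨h1, h2⟩ := hθ
  have h3 := h2 F4highest (mem_F4pos.2 hmem)
  rw [mem_F4pos] at h1
  exact hmax θ h1 ((rootLe_F4pos_iff hmem h1).1 h3)

/-- The abelian upper sets of a list of roots whose smaller members come first, enumerated by
deciding for each root in turn, from the largest to the smallest, whether it may be added. -/
def abelianUpperSets : List (Fin 4 → ℤ) → List (Finset (Fin 4 → ℤ))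
  | [] => [∅]
  | x :: xs => abelianUpperSets xs ++ ((abelianUpperSets xs).filter fun s =>
      (∀ y ∈ xs, simpleNonneg (y - x) → y ∈ s) ∧ ∀ y ∈ s, F4highest ≠ x + y).map (insert x)

lemma mem_abelianUpperSets {l : List (Fin 4 → ℤ)}
    (hl : l.Pairwise fun x y => ¬ simpleNonneg (x - y)) (hl' : ∀ x ∈ l, F4highest ≠ x + x)
    {s : Finset (Fin 4 → ℤ)} :
    s ∈ abelianUpperSets l ↔ (∀ α ∈ s, α ∈ l) ∧
      (∀ α ∈ s, ∀ β ∈ l, simpleNonneg (β - α) → β ∈ s) ∧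
      ∀ α ∈ s, ∀ β ∈ s, F4highest ≠ α + β := by
  induction l generalizing s with
  | nil =>
    simp only [abelianUpperSets, List.mem_singleton]
    refine ⟨fun h => by simp [h], fun h => ?_⟩
    exact Finset.eq_empty_of_forall_notMem fun α hα => List.not_mem_nil (h.1 α hα)
  | cons x xs ih =>
    rw [List.pairwise_cons] at hl
    have hx : x ∉ xs := fun h => hl.1 x h (by simp [simpleNonneg])
    have ih := @ih hl.2 fun y hy => hl' y (List.mem_cons_of_mem x hy)
    have hxx := hl' x List.mem_cons_self
    simp only [abelianUpperSets, List.mem_append, List.mem_map, List.mem_filter, ih,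
      decide_eq_true_eq]
    constructor
    · rintro (⟨h1, h2, h3⟩ | ⟨t, ⟨⟨h1, h2, h3⟩, h4, h5⟩, rfl⟩)
      · refine ⟨fun α hα => List.mem_cons_of_mem x (h1 α hα), fun α hα β hβ h => ?_, h3⟩
        rcases List.mem_cons.1 hβ with rfl | hβ
        · exact absurd h (hl.1 α (h1 α hα))
        · exact h2 α hα β hβ h
      · simp only [Finset.forall_mem_insert, List.forall_mem_cons]
        refine ⟨⟨List.mem_cons_self, fun α hα => List.mem_cons_of_mem x (h1 α hα)⟩,
          ⟨⟨fun _ => Finset.mem_insert_self x t,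
            fun β hβ h => Finset.mem_insert_of_mem (h4 β hβ h)⟩, fun α hα =>
            ⟨fun _ => Finset.mem_insert_self x t,
              fun β hβ h => Finset.mem_insert_of_mem (h2 α hα β hβ h)⟩⟩,
          ⟨hxx, h5⟩, fun α hα => ⟨?_, h3 α hα⟩⟩
        rw [add_comm]
        exact h5 α hα
    · rintro ⟨h1, h2, h3⟩
      have hne : ∀ α ∈ s, α ≠ x → α ∈ xs := fun α hα h =>
        (List.mem_cons.1 (h1 α hα)).resolve_left h
      by_cases hxs : x ∈ s
      · refine Or.inr ⟨s.erase x, ⟨⟨fun α hα => ?_, fun α hα β hβ h => ?_, fun α hα β hβ => ?_⟩,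
          fun β hβ h => ?_, fun β hβ => ?_⟩, Finset.insert_erase hxs⟩
        · exact hne α (Finset.mem_of_mem_erase hα) (Finset.ne_of_mem_erase hα)
        · exact Finset.mem_erase.2 ⟨ne_of_mem_of_not_mem hβ hx,
            h2 α (Finset.mem_of_mem_erase hα) β (List.mem_cons_of_mem x hβ) h⟩
        · exact h3 α (Finset.mem_of_mem_erase hα) β (Finset.mem_of_mem_erase hβ)
        · exact Finset.mem_erase.2 ⟨ne_of_mem_of_not_mem hβ hx,
            h2 x hxs β (List.mem_cons_of_mem x hβ) h⟩
        · exact h3 x hxs β (Finset.mem_of_mem_erase hβ)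
      · exact Or.inl ⟨fun α hα => hne α hα (ne_of_mem_of_not_mem hα hxs),
          fun α hα β hβ h => h2 α hα β (List.mem_cons_of_mem x hβ) h, h3⟩

lemma card_abelianUpperSets : (abelianUpperSets F4abelianSupport).toFinset.card = 16 := by
  decide +kernel

/-- In the root system of type `F₄` with highest root `θ`, the number of
upper sets `Φ` of the poset of positive roots `(Δ⁺, ≤)` such that `θ ∉ Φ²` (where
`Φ² = {α + β : α, β ∈ Φ} ∩ Δ⁺`) is `16 = 2⁴`; equivalently, the Borel subalgebra of the
simple Lie algebra of type `F₄` has exactly `16` abelian ideals. -/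
theorem stmt17 (θ : Fin 4 → ℤ)
    (hθ : θ ∈ F4pos ∧ ∀ α ∈ F4pos, rootLe F4pos α θ) :
    {Φ : Set (Fin 4 → ℤ) | Φ ⊆ F4pos ∧
      (∀ α ∈ Φ, ∀ β ∈ F4pos, rootLe F4pos α β → β ∈ Φ) ∧
      θ ∉ {γ | ∃ α ∈ Φ, ∃ β ∈ Φ, γ = α + β} ∩ F4pos}.ncard = 16 := by
  obtain rfl := eq_F4highest hθ
  have hsub : ∀ α ∈ F4abelianSupport, α ∈ F4posFinset := by decide +kernel
  have hup : ∀ α ∈ F4abelianSupport, ∀ β ∈ F4posFinset,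
      simpleNonneg (β - α) → β ∈ F4abelianSupport := by decide +kernel
  have hord : F4abelianSupport.Pairwise fun x y => ¬ simpleNonneg (x - y) := by decide +kernel
  have hdbl : ∀ x ∈ F4abelianSupport, F4highest ≠ x + x := by decide +kernel
  have hbad : ∀ α ∈ F4posFinset, α ∉ F4abelianSupport → ∃ β ∈ F4posFinset, ∃ γ ∈ F4posFinset,
      simpleNonneg (β - α) ∧ simpleNonneg (γ - α) ∧ F4highest = β + γ := by decide +kernel
  rw [← card_abelianUpperSets, ← Set.ncard_coe_finset,
    ← Set.ncard_image_of_injective _ (Finset.coe_injective (α := Fin 4 → ℤ))]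
  congr 1
  ext Φ
  simp only [Set.mem_ofPred_eq, Set.mem_image, Finset.mem_coe, List.mem_toFinset,
    mem_abelianUpperSets hord hdbl]
  constructor
  · rintro ⟨h1, h2, h3⟩
    have hmem : ∀ α ∈ Φ, α ∈ F4posFinset := fun α hα => mem_F4pos.1 (h1 hα)
    have hclosed : ∀ α ∈ Φ, ∀ β ∈ F4posFinset, simpleNonneg (β - α) → β ∈ Φ :=
      fun α hα β hβ h => h2 α hα β (mem_F4pos.2 hβ) ((rootLe_F4pos_iff (hmem α hα) hβ).2 h)
    have habel : ∀ α ∈ Φ, ∀ β ∈ Φ, F4highest ≠ α + β :=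
      fun α hα β hβ h => h3 ⟨⟨α, hα, β, hβ, h⟩, hθ.1⟩
    have hsupp : ∀ α ∈ Φ, α ∈ F4abelianSupport := fun α hα => by
      by_contra hα'
      obtain ⟨β, hβ, γ, hγ, hαβ, hαγ, h⟩ := hbad α (hmem α hα) hα'
      exact habel β (hclosed α hα β hβ hαβ) γ (hclosed α hα γ hγ hαγ) h
    obtain ⟨s, rfl⟩ := (F4abelianSupport.finite_toSet.subset hsupp).exists_finset_coe
    exact ⟨s, ⟨hsupp,
      fun α hα β hβ h => hclosed α hα β (hsub β hβ) h, habel⟩, rfl⟩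
  · rintro ⟨s, ⟨h1, h2, h3⟩, rfl⟩
    refine ⟨fun α hα => mem_F4pos.2 <| hsub α (h1 α hα), fun α hα β hβ h => ?_,
      fun ⟨⟨α, hα, β, hβ, h⟩, _⟩ => h3 α hα β hβ h⟩
    rw [mem_F4pos] at hβ
    have h' := (rootLe_F4pos_iff (hsub α (h1 α hα)) hβ).1 h
    exact h2 α hα β (hup α (h1 α hα) β hβ h') h'
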